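/- Let u be harmonic on B(p, 2r) ⊂ ℝⁿ with frequency satisfying N ≤ β(p,t) for all t ∈ (s(1-δ), s], where s ∈ [r, 3r/2], δ ∈ [1/(A log^{100} N), 1/(A log² N)] with A = 10⁶ and N ≥ 5 large. Let K = sup_{B(p,s)} |u|. Then sup_{B(p, s(1-δ))} |u| ≤ C·K·2^{-c·δ·N} for constants c, C > 0 depending only on n. -/

import Mathlib

open Real Metric Set MeasureTheory

/-- `u` is harmonic on `s ⊆ ℝⁿ`. -/
def IsHarmonicOn {n : ℕ} (u : EuclideanSpace ℝ (Fin n) → ℝ)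
    (s : Set (EuclideanSpace ℝ (Fin n))) : Prop :=
  ContDiffOn ℝ 2 u s ∧ ∀ x ∈ s,
    ∑ i : Fin n,
      (fderiv ℝ (fun y => fderiv ℝ u y (EuclideanSpace.single i 1)) x)
        (EuclideanSpace.single i 1) = 0

/-- `H p r = ∫_{∂B(p,r)} u² dS`. -/
noncomputable def sphereL2 {n : ℕ} (u : EuclideanSpace ℝ (Fin n) → ℝ)
    (p : EuclideanSpace ℝ (Fin n)) (r : ℝ) : ℝ :=
  r ^ (n - 1) * ∫ y : Metric.sphere (0 : EuclideanSpace ℝ (Fin n)) 1,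
    (u (p + r • (y : EuclideanSpace ℝ (Fin n))))^2 ∂((volume : Measure (EuclideanSpace ℝ (Fin n))).toSphere)

open scoped Topology

/-- The radial weight `(1 - |y|²)₊`. -/
noncomputable def paraboloid {n : ℕ} (y : EuclideanSpace ℝ (Fin n)) : ℝ := max (1 - ‖y‖ ^ 2) 0

section Paraboloid

variable {n : ℕ}

lemma paraboloid_nonneg (y : EuclideanSpace ℝ (Fin n)) : 0 ≤ paraboloid y := le_max_right _ _

lemma paraboloid_le_one (y : EuclideanSpace ℝ (Fin n)) : paraboloid y ≤ 1 :=
  max_le (by nlinarith [sq_nonneg ‖y‖]) zero_le_one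

lemma paraboloid_eq_zero {y : EuclideanSpace ℝ (Fin n)} (hy : 1 ≤ ‖y‖) : paraboloid y = 0 :=
  max_eq_right (by nlinarith)

lemma paraboloid_pos {y : EuclideanSpace ℝ (Fin n)} (hy : ‖y‖ < 1) : 0 < paraboloid y :=
  lt_max_of_lt_left (by nlinarith [norm_nonneg y])

lemma continuous_paraboloid : Continuous (paraboloid (n := n)) := by
  unfold paraboloid; fun_prop

lemma hasCompactSupport_paraboloid : HasCompactSupport (paraboloid (n := n)) :=
  .intro (isCompact_closedBall 0 1) fun y hy => paraboloid_eq_zero (by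
    rw [mem_closedBall, dist_zero_right, not_le] at hy; exact hy.le)

lemma integral_paraboloid_pos : 0 < ∫ y : EuclideanSpace ℝ (Fin n), paraboloid y :=
  continuous_paraboloid.integral_pos_of_hasCompactSupport_nonneg_nonzero
    hasCompactSupport_paraboloid paraboloid_nonneg (x := 0) (paraboloid_pos (by simp)).ne'

lemma hasDerivAt_posPart_sq (a : ℝ) : HasDerivAt (fun a : ℝ => max a 0 ^ 2) (2 * max a 0) a := by
  rcases lt_trichotomy a 0 with h | h | h
  · have : (fun a : ℝ => max a 0 ^ 2) =ᶠ[𝓝 a] fun _ => 0 := by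
      filter_upwards [gt_mem_nhds h] with b hb
      simp [max_eq_right hb.le]
    rw [max_eq_right h.le, mul_zero]
    exact (hasDerivAt_const a (0 : ℝ)).congr_of_eventuallyEq this
  · subst h
    have key : (fun a : ℝ => max a 0 ^ 2) =O[𝓝 0] fun a : ℝ => ‖a - 0‖ ^ 2 := by
      refine Asymptotics.IsBigO.of_bound 1 (.of_forall fun b => ?_)
      rcases le_total b 0 with hb | hb <;> simp [hb, sq_nonneg]
    have := key.hasFDerivAt (𝕜 := ℝ) (n := 2) one_lt_two
    simpa using this.hasDerivAt
  · have : (fun a : ℝ => max a 0 ^ 2) =ᶠ[𝓝 a] fun a => a ^ 2 := by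
      filter_upwards [lt_mem_nhds h] with b hb
      simp [max_eq_left hb.le]
    rw [max_eq_left h.le]
    simpa using (hasDerivAt_pow 2 a).congr_of_eventuallyEq this

/-- `y ↦ -(1 - |y|²)₊² / 4` is a potential of the vector field `(1 - |y|²)₊ y`. -/
lemma hasFDerivAt_paraboloid_potential (y : EuclideanSpace ℝ (Fin n)) :
    HasFDerivAt (fun y : EuclideanSpace ℝ (Fin n) => -(paraboloid y ^ 2) / 4)
      (paraboloid y • innerSL ℝ y) y := by
  have h1 : HasFDerivAt (fun y : EuclideanSpace ℝ (Fin n) => 1 - ‖y‖ ^ 2)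
      (-(2 • innerSL ℝ y)) y := by
    simpa using (hasStrictFDerivAt_norm_sq y).hasFDerivAt.const_sub 1
  have h2 := ((hasDerivAt_posPart_sq (1 - ‖y‖ ^ 2)).comp_hasFDerivAt y h1).const_mul (-1 / 4 : ℝ)
  refine (h2.congr_fderiv ?_).congr_of_eventuallyEq (.of_forall fun z => ?_)
  · ext z
    simp [paraboloid]
    ring
  · simp [paraboloid]
    ring

end Paraboloid

section MeanValue

variable {n : ℕ}

/-- Differentiating a weighted mean in the radius of the ball. -/
lemma hasDerivAt_integral_paraboloid {v : EuclideanSpace ℝ (Fin n) → ℝ} (hv : ContDiff ℝ 1 v)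
    (x : EuclideanSpace ℝ (Fin n)) (t : ℝ) :
    HasDerivAt (fun t : ℝ => ∫ y, v (x + t • y) * paraboloid y)
      (∫ y, fderiv ℝ v (x + t • y) y * paraboloid y) t := by
  have hc' : Continuous fun q : ℝ × EuclideanSpace ℝ (Fin n) =>
      fderiv ℝ v (x + q.1 • q.2) q.2 * paraboloid q.2 := by
    have h := hv.continuous_fderiv one_ne_zero
    have := continuous_paraboloid (n := n)
    fun_prop
  obtain ⟨M, hM⟩ := ((isCompact_closedBall t 1).prod
    (isCompact_closedBall (0 : EuclideanSpace ℝ (Fin n)) 1)).exists_bound_of_continuousOn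
      hc'.continuousOn
  refine (hasDerivAt_integral_of_dominated_loc_of_deriv_le (μ := volume)
    (F := fun t y => v (x + t • y) * paraboloid y)
    (F' := fun t y => fderiv ℝ v (x + t • y) y * paraboloid y)
    (bound := (closedBall (0 : EuclideanSpace ℝ (Fin n)) 1).indicator fun _ => M)
    (ball_mem_nhds t one_pos) ?_ ?_ ?_ ?_ ?_ ?_).2
  · refine .of_forall fun t => Continuous.aestronglyMeasurable ?_
    have := continuous_paraboloid (n := n)
    have := hv.continuous
    fun_prop
  · refine Continuous.integrable_of_hasCompactSupport ?_ hasCompactSupport_paraboloid.mul_left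
    have := continuous_paraboloid (n := n)
    have := hv.continuous
    fun_prop
  · exact (hc'.comp (by fun_prop : Continuous fun y : EuclideanSpace ℝ (Fin n) =>
      (t, y))).aestronglyMeasurable
  · refine .of_forall fun y τ hτ => ?_
    by_cases hy : y ∈ closedBall (0 : EuclideanSpace ℝ (Fin n)) 1
    · rw [indicator_of_mem hy]
      exact hM (τ, y) ⟨ball_subset_closedBall hτ, hy⟩
    · rw [indicator_of_notMem hy]
      rw [mem_closedBall, dist_zero_right, not_le] at hy
      simp [paraboloid_eq_zero hy.le]
  · exact (integrable_indicator_iff measurableSet_closedBall).2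
      (integrableOn_const measure_closedBall_lt_top.ne)
  · refine .of_forall fun y τ _ => ?_
    have h1 : HasDerivAt (fun τ : ℝ => x + τ • y) y τ := by
      simpa using ((hasDerivAt_id τ).smul_const y).const_add x
    exact (((hv.differentiable one_ne_zero).differentiableAt.hasFDerivAt.comp_hasDerivAt τ
      h1)).mul_const _

lemma integral_fderiv_radial_eq_zero {v : EuclideanSpace ℝ (Fin n) → ℝ} (hv : ContDiff ℝ 2 v)
    {x : EuclideanSpace ℝ (Fin n)} {t : ℝ}
    (hΔ : ∀ z ∈ closedBall x |t|, ∑ i : Fin n,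
      (fderiv ℝ (fun y => fderiv ℝ v y (EuclideanSpace.single i 1)) z)
        (EuclideanSpace.single i 1) = 0) :
    ∫ y, fderiv ℝ v (x + t • y) y * paraboloid y = 0 := by
  set e : Fin n → EuclideanSpace ℝ (Fin n) := fun i => EuclideanSpace.single i 1
  set g : EuclideanSpace ℝ (Fin n) → ℝ := fun y => -(paraboloid y ^ 2) / 4
  have hφ := continuous_paraboloid (n := n)
  have hgc : Continuous g := by fun_prop
  have hgs : HasCompactSupport g :=
    hasCompactSupport_paraboloid.comp_left (g := fun a : ℝ => -(a ^ 2) / 4) (by simp)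
  have hg' : ∀ y i, fderiv ℝ g y (e i) = y i * paraboloid y := fun y i => by
    rw [(hasFDerivAt_paraboloid_potential y).fderiv]
    simp [e, mul_comm, EuclideanSpace.inner_single_right]
  have hD : ∀ i, ContDiff ℝ 1 fun y => fderiv ℝ v y (e i) := fun i =>
    (hv.fderiv_right (by norm_num)).clm_apply contDiff_const
  have hDc := fun i => (hD i).continuous
  have hDDc := fun i => (hD i).continuous_fderiv one_ne_zero
  have hf' : ∀ i y, HasFDerivAt (fun y => fderiv ℝ v (x + t • y) (e i))
      (t • fderiv ℝ (fun y => fderiv ℝ v y (e i)) (x + t • y)) y := fun i y => by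
    have h1 : HasFDerivAt (fun y : EuclideanSpace ℝ (Fin n) => x + t • y)
        (t • ContinuousLinearMap.id ℝ _) y := ((hasFDerivAt_id y).const_smul t).const_add x
    refine (((hD i).differentiable one_ne_zero (x + t • y)).hasFDerivAt.comp y h1).congr_fderiv ?_
    ext z; simp
  have hinteg1 : ∀ i, Integrable fun y => fderiv ℝ v (x + t • y) (e i) * fderiv ℝ g y (e i) := by
    intro i
    simp_rw [hg', ← mul_assoc]
    refine Continuous.integrable_of_hasCompactSupport ?_ hasCompactSupport_paraboloid.mul_left
    have := hDc i
    fun_prop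
  have hinteg2 : ∀ i, Integrable fun y =>
      fderiv ℝ (fun y => fderiv ℝ v (x + t • y) (e i)) y (e i) * g y := by
    intro i
    simp_rw [fun y => (hf' i y).fderiv]
    refine Continuous.integrable_of_hasCompactSupport ?_ hgs.mul_left
    have := hDDc i
    simp only [_root_.smul_apply]
    fun_prop
  have hibp : ∀ i, ∫ y, fderiv ℝ v (x + t • y) (e i) * fderiv ℝ g y (e i) =
      -∫ y, fderiv ℝ (fun y => fderiv ℝ v (x + t • y) (e i)) y (e i) * g y := fun i =>
    integral_mul_fderiv_eq_neg_fderiv_mul_of_integrable (hinteg2 i) (hinteg1 i)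
      (Continuous.integrable_of_hasCompactSupport (by have := hDc i; fun_prop) hgs.mul_left)
      (fun y _ => (hf' i y).differentiableAt)
      (fun y _ => (hasFDerivAt_paraboloid_potential y).differentiableAt)
  calc ∫ y, fderiv ℝ v (x + t • y) y * paraboloid y
      = ∫ y, ∑ i, fderiv ℝ v (x + t • y) (e i) * fderiv ℝ g y (e i) := by
        congr 1 with y
        have hy : y = ∑ i, y i • e i := by
          ext j
          simp [e, Finset.sum_apply, Pi.single_apply]
        conv_lhs => rw [show fderiv ℝ v (x + t • y) y
          = fderiv ℝ v (x + t • y) (∑ i, y i • e i) by rw [← hy]]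
        simp_rw [hg', map_sum, map_smul, smul_eq_mul, Finset.sum_mul]
        exact Finset.sum_congr rfl fun i _ => by ring
    _ = ∑ i, -∫ y, fderiv ℝ (fun y => fderiv ℝ v (x + t • y) (e i)) y (e i) * g y := by
        rw [integral_finsetSum _ fun i _ => hinteg1 i]
        exact Finset.sum_congr rfl fun i _ => hibp i
    _ = -∫ y, ∑ i, fderiv ℝ (fun y => fderiv ℝ v (x + t • y) (e i)) y (e i) * g y := by
        rw [Finset.sum_neg_distrib, integral_finsetSum _ fun i _ => hinteg2 i]
    _ = 0 := by
        rw [neg_eq_zero]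
        refine integral_eq_zero_of_ae (.of_forall fun y => ?_)
        simp_rw [fun i => (hf' i y).fderiv, ← Finset.sum_mul]
        rcases le_total 1 ‖y‖ with hy | hy
        · simp [g, paraboloid_eq_zero hy]
        · have := hΔ (x + t • y) (by
            rw [mem_closedBall, dist_self_add_left, norm_smul, Real.norm_eq_abs]
            nlinarith [abs_nonneg t])
          simp only [_root_.smul_apply, smul_eq_mul, ← Finset.mul_sum, e, this]
          simp

/-- Mean value property with the radial weight `(1 - |y|²)₊`. -/
lemma mean_value_of_contDiff {v : EuclideanSpace ℝ (Fin n) → ℝ} (hv : ContDiff ℝ 2 v)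
    {x : EuclideanSpace ℝ (Fin n)} {ρ : ℝ} (hρ : 0 ≤ ρ)
    (hΔ : ∀ z ∈ closedBall x ρ, ∑ i : Fin n,
      (fderiv ℝ (fun y => fderiv ℝ v y (EuclideanSpace.single i 1)) z)
        (EuclideanSpace.single i 1) = 0) :
    ∫ y, v (x + ρ • y) * paraboloid y = v x * ∫ y : EuclideanSpace ℝ (Fin n), paraboloid y := by
  have hd := hasDerivAt_integral_paraboloid (hv.of_le one_le_two) x
  have := constant_of_has_deriv_right_zero (f := fun t : ℝ => ∫ y, v (x + t • y) * paraboloid y)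
    (a := 0) (b := ρ) (fun t _ => (hd t).continuousAt.continuousWithinAt)
    (fun t ht => by
      have h := (hd t).hasDerivWithinAt (s := Ici t)
      rwa [integral_fderiv_radial_eq_zero hv fun z hz => hΔ z (closedBall_subset_closedBall (by
        rw [abs_of_nonneg ht.1]; exact ht.2.le) hz)] at h) ρ ⟨hρ, le_rfl⟩
  simpa [integral_const_mul] using this

/-- A harmonic function on a ball agrees on a smaller ball with a global `C²` function. -/
lemma IsHarmonicOn.exists_contDiff_eqOn {u : EuclideanSpace ℝ (Fin n) → ℝ}
    {x : EuclideanSpace ℝ (Fin n)} {ρ R : ℝ} (hρ : 0 < ρ) (hR : ρ < R)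
    (hu : IsHarmonicOn u (ball x R)) :
    ∃ v, ContDiff ℝ 2 v ∧ EqOn v u (closedBall x ρ) ∧ ∀ z ∈ closedBall x ρ, ∑ i : Fin n,
      (fderiv ℝ (fun y => fderiv ℝ v y (EuclideanSpace.single i 1)) z)
        (EuclideanSpace.single i 1) = 0 := by
  obtain ⟨ρ₁, h1, h1R⟩ := exists_between hR
  obtain ⟨ρ₂, h2, h2R⟩ := exists_between h1R
  let χ : ContDiffBump x := ⟨ρ₁, ρ₂, hρ.trans h1, h2⟩
  have heq : ∀ z ∈ ball x ρ₁, (fun y => χ y * u y) =ᶠ[𝓝 z] u := fun z hz => by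
    filter_upwards [isOpen_ball.mem_nhds hz] with y hy
    rw [χ.one_of_mem_closedBall (ball_subset_closedBall hy), one_mul]
  refine ⟨fun y => χ y * u y, ?_, fun z hz => ?_, fun z hz => ?_⟩
  · rw [contDiff_iff_contDiffAt]
    intro y
    by_cases hy : y ∈ ball x R
    · exact χ.contDiff.contDiffAt.mul (hu.1.contDiffAt (isOpen_ball.mem_nhds hy))
    · have : (fun y => χ y * u y) =ᶠ[𝓝 y] fun _ => 0 := by
        have hy' : y ∈ (closedBall x ρ₂)ᶜ := fun h => hy (closedBall_subset_ball h2R h)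
        filter_upwards [isClosed_closedBall.isOpen_compl.mem_nhds hy'] with z hz
        rw [χ.zero_of_le_dist (not_le.1 (mt mem_closedBall.2 hz)).le, zero_mul]
      exact contDiffAt_const.congr_of_eventuallyEq this
  · exact (heq z (closedBall_subset_ball h1 hz)).eq_of_nhds
  · have hz' := closedBall_subset_ball h1 hz
    rw [← hu.2 z (ball_subset_ball h1R.le hz')]
    refine Finset.sum_congr rfl fun i _ => ?_
    have : (fun y => fderiv ℝ (fun y => χ y * u y) y (EuclideanSpace.single i 1)) =ᶠ[𝓝 z]
        fun y => fderiv ℝ u y (EuclideanSpace.single i 1) :=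
      ((heq z hz').fderiv (𝕜 := ℝ)).mono fun y hy => by simp only [hy]
    rw [this.fderiv_eq]

end MeanValue
section Estimates

variable {n : ℕ}

lemma IsHarmonicOn.mono {u : EuclideanSpace ℝ (Fin n) → ℝ} {s t : Set (EuclideanSpace ℝ (Fin n))}
    (hu : IsHarmonicOn u t) (h : s ⊆ t) : IsHarmonicOn u s :=
  ⟨hu.1.mono h, fun x hx => hu.2 x (h hx)⟩

/-- Maximum principle on balls. -/
lemma IsHarmonicOn.abs_le_of_abs_le_sphere [Nontrivial (EuclideanSpace ℝ (Fin n))]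
    {u : EuclideanSpace ℝ (Fin n) → ℝ} {p : EuclideanSpace ℝ (Fin n)} {R A : ℝ} (hR : 0 ≤ R)
    (hu : IsHarmonicOn u (ball p R)) (hc : ContinuousOn u (closedBall p R))
    (hA : ∀ y ∈ sphere p R, |u y| ≤ A) {x : EuclideanSpace ℝ (Fin n)} (hx : x ∈ closedBall p R) :
    |u x| ≤ A := by
  obtain ⟨x₀, hx₀, hmax⟩ := (isCompact_closedBall p R).exists_isMaxOn
    ⟨p, mem_closedBall_self hR⟩ hc.abs
  refine (hmax hx).trans ?_
  simp only
  by_contra! hlt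
  set M := |u x₀|
  have hT : IsCompact (closedBall p R ∩ (fun y => |u y|) ⁻¹' {M}) :=
    (isCompact_closedBall p R).of_isClosed_subset
      (hc.abs.preimage_isClosed_of_isClosed isClosed_closedBall isClosed_singleton)
      inter_subset_left
  obtain ⟨x₁, ⟨hx₁, hx₁M⟩, hfar⟩ := hT.exists_isMaxOn (f := fun y => ‖y - p‖)
    ⟨x₀, hx₀, rfl⟩ (by fun_prop)
  simp only [mem_preimage, mem_singleton_iff] at hx₁M
  rw [mem_closedBall, dist_eq_norm] at hx₁
  have hd : ‖x₁ - p‖ < R := lt_of_le_of_ne hx₁ fun h => by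
    have := hA x₁ (by rw [mem_sphere, dist_eq_norm, h])
    linarith
  set ρ := (R - ‖x₁ - p‖) / 2 with hρ
  have hρ0 : 0 < ρ := by linarith
  have hu₁ : IsHarmonicOn u (ball x₁ (R - ‖x₁ - p‖)) :=
    hu.mono (ball_subset_ball' (by rw [dist_eq_norm]; linarith))
  obtain ⟨v, hv, hvu, hΔ⟩ := hu₁.exists_contDiff_eqOn hρ0 (by linarith)
  have hball : closedBall x₁ ρ ⊆ closedBall p R :=
    closedBall_subset_closedBall' (by rw [dist_eq_norm]; linarith)
  have hvc := hv.continuous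
  have hφ := continuous_paraboloid (n := n)
  have hmem : ∀ y : EuclideanSpace ℝ (Fin n), ‖y‖ ≤ 1 → x₁ + ρ • y ∈ closedBall x₁ ρ :=
      fun y hy => by
    rw [mem_closedBall, dist_self_add_left, norm_smul, Real.norm_eq_abs, abs_of_pos hρ0]
    nlinarith
  have hle : ∀ y : EuclideanSpace ℝ (Fin n), ‖y‖ ≤ 1 → |v (x₁ + ρ • y)| ≤ M := fun y hy => by
    rw [hvu (hmem y hy)]
    exact hmax (hball (hmem y hy))
  have hconst : ∀ y : EuclideanSpace ℝ (Fin n), ‖y‖ < 1 → |u (x₁ + ρ • y)| = M := by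
    by_contra! hne
    obtain ⟨y, hy, hyne⟩ := hne
    have hinteg : ∀ g : EuclideanSpace ℝ (Fin n) → ℝ, Continuous g →
        Integrable fun y => g y * paraboloid y := fun g hg =>
      (hg.mul hφ).integrable_of_hasCompactSupport hasCompactSupport_paraboloid.mul_left
    have hpos : 0 < ∫ y, (M - |v (x₁ + ρ • y)|) * paraboloid y := by
      refine Continuous.integral_pos_of_hasCompactSupport_nonneg_nonzero (by fun_prop)
        hasCompactSupport_paraboloid.mul_left (fun z => ?_) (x := y) ?_
      · rcases le_total 1 ‖z‖ with hz | hz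
        · simp [paraboloid_eq_zero hz]
        · exact mul_nonneg (sub_nonneg.2 (hle z hz)) (paraboloid_nonneg z)
      · rw [hvu (hmem y hy.le)]
        exact mul_ne_zero (sub_ne_zero.2 hyne.symm) (paraboloid_pos hy).ne'
    have hmv := mean_value_of_contDiff hv hρ0.le hΔ
    have hle' : |∫ y, v (x₁ + ρ • y) * paraboloid y| ≤ ∫ y, |v (x₁ + ρ • y)| * paraboloid y := by
      refine abs_integral_le_integral_abs.trans_eq ?_
      simp_rw [abs_mul, abs_of_nonneg (paraboloid_nonneg _)]
    rw [hmv, abs_mul, abs_of_pos integral_paraboloid_pos, hvu (mem_closedBall_self hρ0.le),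
      hx₁M, ← integral_const_mul] at hle'
    simp_rw [sub_mul] at hpos
    rw [integral_sub (hinteg _ (by fun_prop)) (hinteg _ (by fun_prop))] at hpos
    linarith
  obtain ⟨w, hw⟩ := exists_norm_eq (EuclideanSpace ℝ (Fin n)) (show (0 : ℝ) ≤ 1 / 2 by norm_num)
  have hfar' : ∀ y : EuclideanSpace ℝ (Fin n), ‖y‖ < 1 → ‖(x₁ - p) + ρ • y‖ ≤ ‖x₁ - p‖ :=
    fun y hy => by
      have := hfar ⟨hball (hmem y hy.le), hconst y hy⟩
      simpa [add_sub_right_comm] using this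
  have h1 := hfar' w (by rw [hw]; norm_num)
  have h2 := hfar' (-w) (by rw [norm_neg, hw]; norm_num)
  rw [smul_neg, ← sub_eq_add_neg] at h2
  have hpar := parallelogram_law_with_norm ℝ (x₁ - p) (ρ • w)
  have hw' : 0 < ‖ρ • w‖ := by rw [norm_smul, hw, Real.norm_eq_abs, abs_of_pos hρ0]; positivity
  nlinarith [norm_nonneg (x₁ - p + ρ • w), norm_nonneg (x₁ - p - ρ • w)]

/-- Local boundedness: the value of a harmonic function is controlled by its `L²` norm on a ball. -/
lemma sq_mul_integral_paraboloid_le {v : EuclideanSpace ℝ (Fin n) → ℝ} (hv : Continuous v)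
    {x : EuclideanSpace ℝ (Fin n)} {ρ : ℝ} (hρ : 0 < ρ)
    (hmv : ∫ y, v (x + ρ • y) * paraboloid y =
      v x * ∫ y : EuclideanSpace ℝ (Fin n), paraboloid y) :
    v x ^ 2 * ∫ y : EuclideanSpace ℝ (Fin n), paraboloid y ≤
      (ρ ^ n)⁻¹ * ∫ z in ball x ρ, v z ^ 2 := by
  have hφ := continuous_paraboloid (n := n)
  have hinteg : ∀ g : EuclideanSpace ℝ (Fin n) → ℝ, Continuous g →
      Integrable fun y => g y * paraboloid y := fun g hg =>
    (hg.mul hφ).integrable_of_hasCompactSupport hasCompactSupport_paraboloid.mul_left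
  have hvar : 0 ≤ ∫ y, (v (x + ρ • y) - v x) ^ 2 * paraboloid y :=
    integral_nonneg fun y => mul_nonneg (sq_nonneg _) (paraboloid_nonneg y)
  have hexp : ∫ y, (v (x + ρ • y) - v x) ^ 2 * paraboloid y =
      (∫ y, v (x + ρ • y) ^ 2 * paraboloid y) -
        v x ^ 2 * ∫ y : EuclideanSpace ℝ (Fin n), paraboloid y := by
    have : ∀ y, (v (x + ρ • y) - v x) ^ 2 * paraboloid y = v (x + ρ • y) ^ 2 * paraboloid y
        - 2 * v x * (v (x + ρ • y) * paraboloid y) + v x ^ 2 * paraboloid y := fun y => by ring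
    simp_rw [this]
    have h1 := hinteg (fun y => v (x + ρ • y) ^ 2) (by fun_prop)
    have h2 := (hinteg (fun y => v (x + ρ • y)) (by fun_prop)).const_mul (2 * v x)
    have h12 : Integrable fun y => v (x + ρ • y) ^ 2 * paraboloid y -
        2 * v x * (v (x + ρ • y) * paraboloid y) := h1.sub h2
    have h3 := hinteg (fun _ => v x ^ 2) continuous_const
    rw [integral_add h12 h3, integral_sub h1 h2, integral_const_mul, integral_const_mul,
      hmv]
    ring
  have hcov : ∫ y, (ball x ρ).indicator (fun z => v z ^ 2) (x + ρ • y) =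
      (ρ ^ n)⁻¹ * ∫ z in ball x ρ, v z ^ 2 := by
    have := Measure.integral_comp_smul_of_nonneg volume
      (fun z => (ball x ρ).indicator (fun z => v z ^ 2) (x + z)) ρ (hR := hρ.le)
    rw [this, integral_add_left_eq_self (fun z => (ball x ρ).indicator (fun z => v z ^ 2) z) x,
      integral_indicator measurableSet_ball]
    simp
  rw [← hcov]
  have hind : Integrable ((ball x ρ).indicator fun z => v z ^ 2) :=
    (integrable_indicator_iff measurableSet_ball).2
      (((hv.pow 2).continuousOn.integrableOn_compact (isCompact_closedBall x ρ)).mono_set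
        ball_subset_closedBall)
  refine (by linarith : _ ≤ ∫ y, v (x + ρ • y) ^ 2 * paraboloid y).trans ?_
  refine integral_mono (hinteg _ (by fun_prop)) ?_ fun y => ?_
  · exact (hind.comp_add_left x).comp_smul hρ.ne'
  · simp only
    rcases le_or_gt 1 ‖y‖ with hy | hy
    · rw [paraboloid_eq_zero hy, mul_zero]
      exact indicator_nonneg (fun z _ => sq_nonneg _) _
    · rw [indicator_of_mem (by
        rw [mem_ball, dist_self_add_left, norm_smul, Real.norm_eq_abs, abs_of_pos hρ]
        nlinarith)]
      nlinarith [sq_nonneg (v (x + ρ • y)), paraboloid_le_one y]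

/-- Integration in polar coordinates. -/
lemma lintegral_eq_lintegral_Ioi_sphere [Nontrivial (EuclideanSpace ℝ (Fin n))]
    {g : EuclideanSpace ℝ (Fin n) → ENNReal} (hg : Measurable g) :
    ∫⁻ z, g z = ∫⁻ t in Ioi (0 : ℝ), ENNReal.ofReal (t ^ (n - 1)) *
      ∫⁻ ω : sphere (0 : EuclideanSpace ℝ (Fin n)) 1, g (t • (ω : EuclideanSpace ℝ (Fin n)))
        ∂(volume : Measure (EuclideanSpace ℝ (Fin n))).toSphere := by
  have hmp :=
    (volume : Measure (EuclideanSpace ℝ (Fin n))).measurePreserving_homeomorphUnitSphereProd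
  rw [finrank_euclideanSpace_fin] at hmp
  have hm : Measurable fun q : sphere (0 : EuclideanSpace ℝ (Fin n)) 1 × Ioi (0 : ℝ) =>
      g ((q.2 : ℝ) • (q.1 : EuclideanSpace ℝ (Fin n))) := hg.comp (by fun_prop)
  calc ∫⁻ z, g z = ∫⁻ z : ({0}ᶜ : Set (EuclideanSpace ℝ (Fin n))), g z
          ∂(volume : Measure (EuclideanSpace ℝ (Fin n))).comap (↑) := by
        rw [lintegral_subtype_comap (measurableSet_singleton _).compl, restrict_compl_singleton]
    _ = ∫⁻ q, g ((q.2 : ℝ) • (q.1 : EuclideanSpace ℝ (Fin n)))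
          ∂(volume : Measure (EuclideanSpace ℝ (Fin n))).toSphere.prod
            (Measure.volumeIoiPow (n - 1)) := by
        rw [← hmp.lintegral_comp hm]
        refine lintegral_congr fun z => ?_
        congr 1
        have hz : ‖(z : EuclideanSpace ℝ (Fin n))‖ ≠ 0 := norm_ne_zero_iff.2 z.2
        simp [smul_smul, hz]
    _ = ∫⁻ t : Ioi (0 : ℝ), ∫⁻ ω : sphere (0 : EuclideanSpace ℝ (Fin n)) 1,
          g ((t : ℝ) • (ω : EuclideanSpace ℝ (Fin n)))
          ∂(volume : Measure (EuclideanSpace ℝ (Fin n))).toSphere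
          ∂(Measure.volumeIoiPow (n - 1)) := lintegral_prod_symm' _ hm
    _ = _ := by
        rw [Measure.volumeIoiPow, lintegral_withDensity_eq_lintegral_mul _ (by fun_prop)
          hm.lintegral_prod_left']
        exact lintegral_subtype_comap measurableSet_Ioi (fun t : ℝ => ENNReal.ofReal (t ^ (n - 1)) *
          ∫⁻ ω : sphere (0 : EuclideanSpace ℝ (Fin n)) 1, g (t • (ω : EuclideanSpace ℝ (Fin n)))
          ∂(volume : Measure (EuclideanSpace ℝ (Fin n))).toSphere)

lemma setIntegral_le_of_sphere_integral_le [Nontrivial (EuclideanSpace ℝ (Fin n))]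
    {f : EuclideanSpace ℝ (Fin n) → ℝ} (hf : Continuous f) (hf0 : ∀ z, 0 ≤ f z)
    {p : EuclideanSpace ℝ (Fin n)} {D : Set (EuclideanSpace ℝ (Fin n))} (hD : MeasurableSet D)
    {a b B : ℝ} (hab : a ≤ b) (hB : 0 ≤ B) (hDab : ∀ z ∈ D, ‖z - p‖ ∈ Ioo a b)
    (hfB : ∀ t ∈ Ioo a b, 0 < t →
      t ^ (n - 1) * ∫ ω : sphere (0 : EuclideanSpace ℝ (Fin n)) 1,
        f (p + t • (ω : EuclideanSpace ℝ (Fin n)))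
        ∂(volume : Measure (EuclideanSpace ℝ (Fin n))).toSphere ≤ B) :
    ∫ z in D, f z ≤ B * (b - a) := by
  rw [integral_eq_lintegral_of_nonneg_ae (.of_forall hf0) hf.aestronglyMeasurable]
  refine ENNReal.toReal_le_of_le_ofReal (mul_nonneg hB (sub_nonneg.2 hab)) ?_
  set g : EuclideanSpace ℝ (Fin n) → ENNReal := D.indicator fun z => ENNReal.ofReal (f z)
  have hgm : Measurable g := hf.measurable.ennreal_ofReal.indicator hD
  rw [← lintegral_indicator hD, ← lintegral_add_left_eq_self g p,
    lintegral_eq_lintegral_Ioi_sphere (g := fun z => g (p + z)) (by fun_prop)]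
  calc _ ≤ ∫⁻ t in Ioi (0 : ℝ), (Ioo a b).indicator (fun _ => ENNReal.ofReal B) t := by
        refine setLIntegral_mono' measurableSet_Ioi fun t (ht : 0 < t) => ?_
        by_cases htab : t ∈ Ioo a b
        · rw [indicator_of_mem htab]
          refine le_trans ?_ (ENNReal.ofReal_le_ofReal (hfB t htab ht))
          rw [ENNReal.ofReal_mul (by positivity), ofReal_integral_eq_lintegral_ofReal
            (Continuous.integrable_of_hasCompactSupport (by fun_prop) (.of_compactSpace _))
            (.of_forall fun ω => hf0 _)]
          gcongr with ω
          exact indicator_le_self _ _ _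
        · rw [indicator_of_notMem htab, nonpos_iff_eq_zero, mul_eq_zero]
          right
          refine lintegral_eq_zero_of_ae_eq_zero (.of_forall fun ω => ?_)
          refine indicator_of_notMem (fun hmem => htab ?_) _
          have := hDab _ hmem
          simpa [norm_smul, abs_of_pos ht] using this
    _ ≤ ∫⁻ t, (Ioo a b).indicator (fun _ => ENNReal.ofReal B) t := setLIntegral_le_lintegral _ _
    _ = ENNReal.ofReal (B * (b - a)) := by
        rw [lintegral_indicator measurableSet_Ioo, setLIntegral_const, Real.volume_Ioo,
          ENNReal.ofReal_mul hB]

end Estimates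

/-- A lower bound on the frequency forces polynomial growth. -/
lemma le_rpow_mul_of_frequency_ge {H H' : ℝ → ℝ} {N t s : ℝ} (ht : 0 < t) (hts : t ≤ s)
    (hd : ∀ τ ∈ Icc t s, HasDerivAt H (H' τ) τ) (hpos : ∀ τ ∈ Icc t s, 0 < H τ)
    (hN : ∀ τ ∈ Icc t s, N ≤ τ * H' τ / (2 * H τ)) :
    H t ≤ (t / s) ^ (2 * N) * H s := by
  have hs : 0 < s := ht.trans_le hts
  have hd' : ∀ τ ∈ Icc t s, HasDerivAt (fun τ => H τ * τ ^ (-(2 * N)))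
      (H' τ * τ ^ (-(2 * N)) + H τ * (-(2 * N) * τ ^ (-(2 * N) - 1))) τ := fun τ hτ =>
    (hd τ hτ).mul (Real.hasDerivAt_rpow_const (.inl (ht.trans_le hτ.1).ne'))
  have hmono : MonotoneOn (fun τ => H τ * τ ^ (-(2 * N))) (Icc t s) := by
    refine monotoneOn_of_deriv_nonneg (convex_Icc t s)
      (fun τ hτ => (hd' τ hτ).continuousAt.continuousWithinAt) (fun τ hτ =>
        (hd' τ (interior_subset hτ)).differentiableAt.differentiableWithinAt) fun τ hτ => ?_
    have hτ := interior_subset hτ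
    have hτ0 : 0 < τ := ht.trans_le hτ.1
    have hH := hpos τ hτ
    rw [(hd' τ hτ).deriv, Real.rpow_sub_one hτ0.ne']
    have h1 := (le_div_iff₀ (by positivity)).1 (hN τ hτ)
    have : H' τ * τ ^ (-(2 * N)) + H τ * (-(2 * N) * (τ ^ (-(2 * N)) / τ)) =
        τ ^ (-(2 * N)) / τ * (τ * H' τ - N * (2 * H τ)) := by
      field_simp
      ring
    rw [this]
    exact mul_nonneg (by positivity) (by linarith)
  have h := hmono ⟨le_rfl, hts⟩ ⟨hts, le_rfl⟩ hts
  simp only [Real.rpow_neg ht.le, Real.rpow_neg hs.le] at h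
  rw [Real.div_rpow ht.le hs.le]
  have h1 : 0 < t ^ (2 * N) := by positivity
  have h2 : 0 < s ^ (2 * N) := by positivity
  rw [← div_eq_mul_inv, ← div_eq_mul_inv, div_le_div_iff₀ h1 h2] at h
  rw [div_mul_eq_mul_div, le_div_iff₀ h2]
  linarith
lemma IsHarmonicOn.sq_le_of_frequency_ge {n : ℕ} {u : EuclideanSpace ℝ (Fin n) → ℝ}
    [Nontrivial (EuclideanSpace ℝ (Fin n))] {p : EuclideanSpace ℝ (Fin n)} {R s δ N K : ℝ}
    {H' : ℝ → ℝ} (hs : 0 < s) (hsR : s < R) (hδ0 : 0 < δ) (hδ1 : δ < 1) (hN : 0 ≤ N)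
    (hu : IsHarmonicOn u (ball p R))
    (hH' : ∀ t ∈ Ioc (s * (1 - δ)) s, HasDerivAt (sphereL2 u p) (H' t) t)
    (hpos : ∀ t ∈ Ioc (s * (1 - δ)) s, 0 < sphereL2 u p t)
    (hfreq : ∀ t ∈ Ioc (s * (1 - δ)) s, N ≤ t * H' t / (2 * sphereL2 u p t))
    (hK : ∀ y ∈ closedBall p s, |u y| ≤ K)
    {x : EuclideanSpace ℝ (Fin n)} (hx : x ∈ sphere p (s * (1 - δ / 2))) :
    u x ^ 2 * ∫ y : EuclideanSpace ℝ (Fin n), paraboloid y ≤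
      4 ^ n * (volume : Measure (EuclideanSpace ℝ (Fin n))).toSphere.real univ * δ⁻¹ ^ n *
        Real.exp (-(δ * N / 2)) * K ^ 2 := by
  set σ := (volume : Measure (EuclideanSpace ℝ (Fin n))).toSphere.real univ with hσ
  have hn : n ≠ 0 := by
    rintro rfl
    exact not_subsingleton (EuclideanSpace ℝ (Fin 0)) inferInstance
  have hsδ : 0 < s * δ := mul_pos hs hδ0
  obtain ⟨v, hv, hvu, hΔ⟩ := hu.exists_contDiff_eqOn hs hsR
  have hvc := hv.continuous
  have hmemS : ∀ t, 0 < t → t ≤ s → ∀ ω : sphere (0 : EuclideanSpace ℝ (Fin n)) 1,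
      p + t • (ω : EuclideanSpace ℝ (Fin n)) ∈ closedBall p s := fun t ht hts ω => by
    simpa [norm_smul, abs_of_pos ht] using hts
  have hL2 : ∀ t, 0 < t → t ≤ s → sphereL2 u p t =
      t ^ (n - 1) * ∫ ω : sphere (0 : EuclideanSpace ℝ (Fin n)) 1,
        v (p + t • (ω : EuclideanSpace ℝ (Fin n))) ^ 2
        ∂(volume : Measure (EuclideanSpace ℝ (Fin n))).toSphere := fun t ht hts => by
    unfold sphereL2
    congr 2 with ω
    rw [hvu (hmemS t ht hts ω)]
  have hHs : sphereL2 u p s ≤ s ^ (n - 1) * (σ * K ^ 2) := by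
    rw [hL2 s hs le_rfl]
    gcongr
    rw [hσ, ← smul_eq_mul, ← integral_const]
    refine integral_mono
      (Continuous.integrable_of_hasCompactSupport (by fun_prop) (.of_compactSpace _))
      (integrable_const _) fun ω => ?_
    have hmem := hmemS s hs le_rfl ω
    simp only
    rw [hvu hmem, ← sq_abs]
    exact pow_le_pow_left₀ (abs_nonneg _) (hK _ hmem) 2
  set B := Real.exp (-(δ * N / 2)) * (s ^ (n - 1) * (σ * K ^ 2)) with hB
  have hB0 : 0 ≤ B := by positivity
  have hHt : ∀ t ∈ Ioo (s * (1 - 3 / 4 * δ)) (s * (1 - δ / 4)), sphereL2 u p t ≤ B := by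
    intro t ht
    have ht0 : 0 < t := lt_of_le_of_lt (mul_nonneg hs.le (by linarith)) ht.1
    have hts : t ≤ s := ht.2.le.trans (by nlinarith)
    have hsub : Icc t s ⊆ Ioc (s * (1 - δ)) s := fun τ hτ =>
      ⟨lt_of_lt_of_le (by nlinarith [ht.1]) hτ.1, hτ.2⟩
    refine (le_rpow_mul_of_frequency_ge ht0 hts (fun τ hτ => hH' τ (hsub hτ))
      (fun τ hτ => hpos τ (hsub hτ)) (fun τ hτ => hfreq τ (hsub hτ))).trans ?_
    have hle : t / s ≤ Real.exp (-(δ / 4)) := by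
      refine le_trans ?_ (Real.one_sub_le_exp_neg _)
      rw [div_le_iff₀ hs]
      linarith [ht.2]
    have hpow : (t / s) ^ (2 * N) ≤ Real.exp (-(δ * N / 2)) := by
      refine (Real.rpow_le_rpow (by positivity) hle (by positivity)).trans_eq ?_
      rw [← Real.exp_mul]
      ring_nf
    exact mul_le_mul hpow hHs (hpos s (hsub ⟨hts, le_rfl⟩)).le (Real.exp_pos _).le
  rw [mem_sphere, dist_eq_norm] at hx
  have hρ : 0 < s * δ / 4 := by positivity
  have hxs : closedBall x (s * δ / 4) ⊆ closedBall p s :=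
    closedBall_subset_closedBall' (by rw [dist_eq_norm, hx]; nlinarith)
  have hmv := mean_value_of_contDiff hv hρ.le fun z hz => hΔ z (hxs hz)
  have hloc := sq_mul_integral_paraboloid_le hvc hρ hmv
  rw [hvu (hxs (mem_closedBall_self hρ.le))] at hloc
  have hinteg : ∫ z in ball x (s * δ / 4), v z ^ 2 ≤
      B * (s * (1 - δ / 4) - s * (1 - 3 / 4 * δ)) := by
    refine setIntegral_le_of_sphere_integral_le (f := fun z => v z ^ 2) (p := p) (by fun_prop)
      (fun z => sq_nonneg _) measurableSet_ball (by nlinarith) hB0 (fun z hz => ?_)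
      fun t ht ht0 => ?_
    · rw [mem_ball, dist_eq_norm] at hz
      have h1 := norm_sub_norm_le (x - p) (z - p)
      have h2 := norm_sub_norm_le (z - p) (x - p)
      rw [sub_sub_sub_cancel_right, hx] at h1 h2
      rw [norm_sub_rev x z] at h1
      constructor <;> nlinarith
    · rw [← hL2 t ht0 (ht.2.le.trans (by nlinarith))]
      exact hHt t ht
  refine hloc.trans ?_
  calc ((s * δ / 4) ^ n)⁻¹ * ∫ z in ball x (s * δ / 4), v z ^ 2
      ≤ ((s * δ / 4) ^ n)⁻¹ * (B * s) := by
        gcongr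
        refine hinteg.trans (mul_le_mul_of_nonneg_left ?_ hB0)
        nlinarith
    _ = _ := by
        obtain ⟨m, rfl⟩ := Nat.exists_eq_succ_of_ne_zero hn
        simp only [hB, Nat.succ_eq_add_one, Nat.add_sub_cancel, inv_pow, div_pow, mul_pow]
        field_simp
        ring

lemma exists_forall_sq_log_pow_le :
    ∃ N₁ : ℝ, 5 ≤ N₁ ∧ ∀ N, N₁ ≤ N → (10 ^ 6 * Real.log N ^ 100) ^ 2 ≤ N := by
  have h := (isLittleO_pow_log_id_atTop (n := 200)).bound (show (0 : ℝ) < 1 / 10 ^ 12 by norm_num)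
  obtain ⟨N₀, hN₀⟩ := Filter.eventually_atTop.1 h
  refine ⟨max 5 N₀, le_max_left _ _, fun N hN => ?_⟩
  have h5 : (5 : ℝ) ≤ N := (le_max_left _ _).trans hN
  have h := hN₀ N ((le_max_right _ _).trans hN)
  rw [Real.norm_eq_abs, Real.norm_eq_abs, id, abs_of_nonneg (by linarith : (0 : ℝ) ≤ N)] at h
  have h' := (le_abs_self _).trans h
  calc (10 ^ 6 * Real.log N ^ 100) ^ 2 = 10 ^ 12 * Real.log N ^ 200 := by ring
    _ ≤ N := by linarith

lemma inv_pow_mul_exp_le {δ N : ℝ} (n : ℕ) (hδ : 0 < δ) (h : δ⁻¹ ≤ δ * N) :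
    δ⁻¹ ^ n * Real.exp (-(δ * N / 2)) ≤ 4 ^ n * n.factorial * Real.exp (-(δ * N / 4)) := by
  have h1 : (δ⁻¹ / 4) ^ n / n.factorial ≤ Real.exp (δ * N / 4) :=
    (Real.pow_div_factorial_le_exp _ (by positivity) n).trans (Real.exp_le_exp.2 (by linarith))
  rw [div_le_iff₀ (by positivity), div_pow, div_le_iff₀ (by positivity)] at h1
  calc δ⁻¹ ^ n * Real.exp (-(δ * N / 2))
      ≤ (Real.exp (δ * N / 4) * n.factorial * 4 ^ n) * Real.exp (-(δ * N / 2)) := by gcongr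
    _ = 4 ^ n * n.factorial * (Real.exp (δ * N / 4) * Real.exp (-(δ * N / 2))) := by ring
    _ = _ := by rw [← Real.exp_add]; ring_nf

/-- Inequality (eq:s-): if `u` is harmonic on `B(p,2r) ⊂ ℝⁿ` with frequency `β(p,t) ≥ N` on
`(s(1-δ), s]`, where `s ∈ [r, 3r/2]`, `δ ∈ [1/(10⁶ log¹⁰⁰N), 1/(10⁶ log²N)]` and `N ≥ 5` is
large, then with `K = sup_{B(p,s)}|u|` one has `sup_{B(p,s(1-δ))}|u| ≤ C K 2^{-cδN}`
for constants `c, C > 0` depending only on the dimension `n`. -/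
theorem decay_below_maximum (n : ℕ) :
    ∃ c : ℝ, 0 < c ∧ ∃ C : ℝ, 0 < C ∧ ∃ N₁ : ℝ, 5 ≤ N₁ ∧
      ∀ (u : EuclideanSpace ℝ (Fin n) → ℝ) (p : EuclideanSpace ℝ (Fin n)) (r s δ N : ℝ),
        0 < r →
        IsHarmonicOn u (ball p (2 * r)) →
        s ∈ Set.Icc r (3 / 2 * r) →
        N₁ ≤ N →
        δ ∈ Set.Icc (1 / (10^6 * (Real.log N)^100)) (1 / (10^6 * (Real.log N)^2)) →
        ∀ H' : ℝ → ℝ,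
        (∀ t ∈ Set.Ioo (0:ℝ) (2 * r), HasDerivAt (sphereL2 u p) (H' t) t) →
        (∀ t ∈ Set.Ioo (0:ℝ) (2 * r), 0 < sphereL2 u p t) →
        (∀ t ∈ Set.Ioc (s * (1 - δ)) s,
          N ≤ t * H' t / (2 * sphereL2 u p t)) →
        ∀ K : ℝ, K = sSup ((fun y => |u y|) '' ball p s) →
        sSup ((fun y => |u y|) '' ball p (s * (1 - δ))) ≤
          C * K * 2 ^ (-(c * δ * N)) := by
  obtain ⟨N₁, hN₁5, hN₁⟩ := exists_forall_sq_log_pow_le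
  set I := ∫ y : EuclideanSpace ℝ (Fin n), paraboloid y
  have hI0 : 0 < I := integral_paraboloid_pos
  set σ := (volume : Measure (EuclideanSpace ℝ (Fin n))).toSphere.real univ with hσ
  set C₀ : ℝ := 4 ^ n * σ * (4 ^ n * n.factorial) / I + 1 with hC₀
  have hC₀pos : 0 < C₀ := by positivity
  refine ⟨1 / 8, by norm_num, √C₀, Real.sqrt_pos.2 hC₀pos, N₁, hN₁5, ?_⟩
  intro u p r s δ N hr hu hs hN hδ H' hH' hpos hfreq K hK
  have hN5 : 5 ≤ N := hN₁5.trans hN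
  have hlog : 1 < Real.log N := by
    rw [Real.lt_log_iff_exp_lt (by linarith)]
    linarith [Real.exp_one_lt_d9]
  have hs0 : 0 < s := hr.trans_le hs.1
  have hs2 : s < 2 * r := by linarith [hs.2]
  have hδ0 : 0 < δ := lt_of_lt_of_le (by positivity) hδ.1
  have hδ1 : δ < 1 := hδ.2.trans_lt (by
    rw [div_lt_one (by positivity)]
    nlinarith)
  have hδN : δ⁻¹ ≤ δ * N := by
    have h1 : δ⁻¹ ≤ 10 ^ 6 * Real.log N ^ 100 := by
      rw [inv_le_comm₀ hδ0 (by positivity), ← one_div]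
      exact hδ.1
    have h2 : δ⁻¹ ^ 2 ≤ N := (pow_le_pow_left₀ (by positivity) h1 2).trans (hN₁ N hN)
    calc δ⁻¹ = δ * δ⁻¹ ^ 2 := by field_simp
      _ ≤ δ * N := by gcongr
  have hsub : Ioc (s * (1 - δ)) s ⊆ Ioo 0 (2 * r) := fun t ht =>
    ⟨lt_of_le_of_lt (mul_nonneg hs0.le (by linarith)) ht.1, ht.2.trans_lt hs2⟩
  have : Nontrivial (EuclideanSpace ℝ (Fin n)) := by
    by_contra hnt
    rw [not_nontrivial_iff_subsingleton] at hnt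
    have h := hpos r ⟨hr, by linarith⟩
    rw [sphereL2, (Measure.toSphere_eq_zero_iff _).2 hnt] at h
    simp at h
  have hc : ContinuousOn u (ball p (2 * r)) := hu.1.continuousOn
  have hcs : ContinuousOn u (closedBall p s) := hc.mono (closedBall_subset_ball hs2)
  have hbdd : BddAbove ((fun y => |u y|) '' ball p s) :=
    ((isCompact_closedBall p s).bddAbove_image hcs.abs).mono (image_mono ball_subset_closedBall)
  have hKball : ∀ y ∈ ball p s, |u y| ≤ K := fun y hy =>
    hK ▸ le_csSup hbdd (mem_image_of_mem _ hy)
  have hKle : ∀ y ∈ closedBall p s, |u y| ≤ K := by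
    rw [← closure_ball p hs0.ne'] at hcs ⊢
    exact fun y hy => le_on_closure hKball hcs.abs continuousOn_const hy
  have hK0 : 0 ≤ K := (abs_nonneg _).trans (hKle p (mem_closedBall_self hs0.le))
  have hC : C₀ * Real.exp (-(δ * N / 4)) * K ^ 2 =
      (√C₀ * K * Real.exp (-(δ * N / 8))) ^ 2 := by
    rw [mul_pow, mul_pow, Real.sq_sqrt hC₀pos.le, ← Real.exp_nat_mul]
    ring_nf
  have hsphere : ∀ y ∈ sphere p (s * (1 - δ / 2)),
      |u y| ≤ √C₀ * K * Real.exp (-(δ * N / 8)) := by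
    intro y hy
    have h1 := hu.sq_le_of_frequency_ge hs0 hs2 hδ0 hδ1 (by linarith)
      (fun t ht => hH' t (hsub ht)) (fun t ht => hpos t (hsub ht)) hfreq hKle hy
    refine abs_le_of_sq_le_sq ?_ (by positivity)
    rw [← hC]
    refine le_of_mul_le_mul_right (h1.trans ?_) hI0
    calc 4 ^ n * σ * δ⁻¹ ^ n * Real.exp (-(δ * N / 2)) * K ^ 2
        = 4 ^ n * σ * (δ⁻¹ ^ n * Real.exp (-(δ * N / 2))) * K ^ 2 := by ring
      _ ≤ 4 ^ n * σ * (4 ^ n * n.factorial * Real.exp (-(δ * N / 4))) * K ^ 2 := by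
          gcongr 4 ^ n * σ * ?_ * K ^ 2
          exact inv_pow_mul_exp_le n hδ0 hδN
      _ = (4 ^ n * σ * (4 ^ n * n.factorial) / I) * Real.exp (-(δ * N / 4)) * K ^ 2 * I := by
          field_simp
      _ ≤ C₀ * Real.exp (-(δ * N / 4)) * K ^ 2 * I := by
          gcongr
          exact le_add_of_nonneg_right zero_le_one
  have hexp : Real.exp (-(δ * N / 8)) ≤ 2 ^ (-(1 / 8 * δ * N)) := by
    rw [Real.rpow_def_of_pos two_pos, Real.exp_le_exp]
    have : 0 ≤ δ * N := by positivity
    nlinarith [Real.log_two_lt_d9]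
  have hR2 : s * (1 - δ / 2) ≤ s := by nlinarith
  refine Real.sSup_le ?_ (by positivity)
  rintro _ ⟨y, hy, rfl⟩
  refine (IsHarmonicOn.abs_le_of_abs_le_sphere (mul_nonneg hs0.le (by linarith))
    (hu.mono (ball_subset_ball (hR2.trans hs2.le)))
    (hcs.mono (closedBall_subset_closedBall hR2)) hsphere
    (closedBall_subset_closedBall (by nlinarith) (ball_subset_closedBall hy))).trans ?_
  gcongr
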